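/- arXiv:2302.03286 — 3 statements merged into one kernel-verified Lean document; each statement's English description precedes it below -/
import Mathlib

section
/- Let N, M ∈ ℕ, T ∈ (0,∞), H = T/M, let A ∈ ℝ^{N×N}, let f : ℝ → ℝ, let p = (p_1, p_2) ∈ (0,∞)² be such that I_N − H p_2 A is invertible, and let W_{p} = (W_{p,1},…,W_{p,5}) ∈ (ℝ^{N×N})^5 be given by W_{p,1} = (I_N − H p_2 A)^{−1}(I_N + H(1 − p_2)A) + H²(1/2 − p_2)[(I_N − H p_2 A)^{−1}A]², W_{p,2} = H(1 − 1/(2p_1))(I_N − H p_2 A)^{−1} + H²(1/2 − p_2)(I_N − H p_2 A)^{−1}A(I_N − H p_2 A)^{−1}, W_{p,3} = (H/(2p_1))(I_N − H p_2 A)^{−1}, W_{p,4} = (I_N − H p_2 A)^{−1}(I_N + H(p_1 − p_2)A), W_{p,5} = H p_1 (I_N − H p_2 A)^{−1}. Define the base model realization: set U_0 = V for V ∈ ℝ^N and U_m = W_{p,1} U_{m−1} + W_{p,2} f^{⊗N}(U_{m−1}) + W_{p,3} f^{⊗N}( W_{p,4} U_{m−1} + W_{p,5} f^{⊗N}(U_{m−1})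 ) for m ∈ {1,…,M}, where f^{⊗N} denotes componentwise application of f. Then U_M equals the M-fold composition (φ_p^{H} ∘ ⋯ ∘ φ_p^{H})(V) of the two-stage LIRK one-step map with step size H applied to V. -/
open Matrix

/-- Resolvent identity: `B` is a left inverse of `1 - b • A`, so `B * (1 + (a - b) • A)` is a
perturbation of the identity. -/
lemma resolvent_mul_one_add_smul {n R : Type*} [Fintype n] [DecidableEq n] [CommRing R]
    {A B : Matrix n n R} {b : R} (hB : B * (1 - b • A) = 1) (a : R) :
    B * (1 + (a - b) • A) = 1 + a • (B * A) := by
  have h : (1 + (a - b) • A : Matrix n n R) = (1 - b • A) + a • A := by module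
  rw [h, mul_add, hB, mul_smul_comm]

/-- An orbit of `φ` on the first `M` steps is given by iterating `φ`. -/
lemma eq_iterate_of_forall_lt {α : Type*} {φ : α → α} {U : ℕ → α} {M : ℕ}
    (h : ∀ m < M, U (m + 1) = φ (U m)) : U M = φ^[M] (U 0) := by
  induction M with
  | zero => rfl
  | succ M ih =>
    rw [h M M.lt_succ_self, ih fun m hm => h m (hm.trans M.lt_succ_self),
      Function.iterate_succ_apply']

/-- The realization of the base model with the specialized initialization
parameters `W_p = (W_{p,1}, …, W_{p,5})` coincides with the `M`-fold
composition of the two-stage LIRK one-step map `φ_p^{T/M}`. -/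
theorem base_model_realization_eq_lirk_iterate
    (N M : ℕ) (hM : 0 < M) (T : ℝ) (hT : 0 < T) (H : ℝ) (hH : H = T / M)
    (A : Matrix (Fin N) (Fin N) ℝ) (f : ℝ → ℝ)
    (fN : (Fin N → ℝ) → (Fin N → ℝ)) (hfN : ∀ (v : Fin N → ℝ) (i : Fin N), fN v i = f (v i))
    (p₁ p₂ : ℝ) (hp₁ : 0 < p₁) (hp₂ : 0 < p₂)
    (hinv : IsUnit ((1 : Matrix (Fin N) (Fin N) ℝ) - (H * p₂) • A))
    (B W₁ W₂ W₃ W₄ W₅ : Matrix (Fin N) (Fin N) ℝ)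
    (hB : B = ((1 : Matrix (Fin N) (Fin N) ℝ) - (H * p₂) • A)⁻¹)
    (hW₁ : W₁ = B * (1 + (H * (1 - p₂)) • A) + (H ^ 2 * (1 / 2 - p₂)) • (B * A) ^ 2)
    (hW₂ : W₂ = (H * (1 - 1 / (2 * p₁))) • B + (H ^ 2 * (1 / 2 - p₂)) • (B * A * B))
    (hW₃ : W₃ = (H / (2 * p₁)) • B)
    (hW₄ : W₄ = B * (1 + (H * (p₁ - p₂)) • A))
    (hW₅ : W₅ = (H * p₁) • B)
    (φ : (Fin N → ℝ) → (Fin N → ℝ))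
    (hφ : ∀ (V k₁ k₂ : Fin N → ℝ),
      k₁ = B.mulVec (A.mulVec V + fN V) →
      k₂ = B.mulVec
          (A.mulVec (V + (2 * H * p₁ * (1 / 2 - p₂)) • k₁) + fN (V + (H * p₁) • k₁)) →
      φ V = V + H • ((1 - 1 / (2 * p₁)) • k₁ + (1 / (2 * p₁)) • k₂))
    (V : Fin N → ℝ) (U : ℕ → (Fin N → ℝ))
    (hU0 : U 0 = V)
    (hUrec : ∀ m : ℕ, m < M →
      U (m + 1) = W₁.mulVec (U m) + W₂.mulVec (fN (U m))
        + W₃.mulVec (fN (W₄.mulVec (U m) + W₅.mulVec (fN (U m))))) :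
    U M = φ^[M] V := by
  have hBinv : B * (1 - (H * p₂) • A) = 1 := by
    rw [hB, nonsing_inv_mul _ ((isUnit_iff_isUnit_det _).mp hinv)]
  rw [mul_sub, mul_one, resolvent_mul_one_add_smul hBinv] at hW₁
  rw [mul_sub, resolvent_mul_one_add_smul hBinv] at hW₄
  subst hU0
  refine eq_iterate_of_forall_lt fun m hm => ?_
  rw [hUrec m hm, hφ (U m) _ _ rfl rfl]
  have hstage : W₄ *ᵥ U m + W₅ *ᵥ fN (U m)
      = U m + (H * p₁) • B *ᵥ (A *ᵥ U m + fN (U m)) := by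
    simp only [hW₄, hW₅, add_mulVec, one_mulVec, smul_mulVec, mulVec_add, ← mulVec_mulVec]
    module
  rw [hstage]
  generalize fN (U m + (H * p₁) • B *ᵥ (A *ᵥ U m + fN (U m))) = F
  simp only [hW₁, hW₂, hW₃, pow_two (B * A), add_mulVec, one_mulVec, smul_mulVec, mulVec_add,
    mulVec_smul, ← mulVec_mulVec]
  match_scalars <;> field_simp <;> ring
end

section
/- Let d ∈ ℕ, let A ∈ ℝ^{d×d}, let f : ℝ^d → ℝ^d be twice continuously differentiable, let p = (p_1, p_2) ∈ (0,∞)², and let U ∈ ℝ^d. Then, as h → 0⁺ (with h small enough so that I_d − h p_2 A is invertible), the two-stage LIRK one-step map satisfies φ_p^h(U) = U + h (A U + f(U)) + (h²/2) ( A + Df(U) )( A U + f(U) ) + O(h³), where Df(U) denotes the Jacobian matrix of f at U. -/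
open Matrix Filter Asymptotics

open scoped Topology Matrix.Norms.Operator

/-- First-order Taylor expansion of a curve with quadratic remainder. -/
theorem ContDiffAt.isBigO_sub_sub_smul_deriv {E : Type*} [NormedAddCommGroup E] [NormedSpace ℝ E]
    {g : ℝ → E} {g' : E} {a : ℝ} (hg : ContDiffAt ℝ 2 g a) (hg' : HasDerivAt g g' a) :
    (fun x => g x - g a - (x - a) • g') =O[𝓝 a] fun x => (x - a) ^ 2 := by
  obtain ⟨u, hu, hgu⟩ := hg.contDiffOn le_rfl (by simp)
  obtain ⟨ε, hε, hεu⟩ := Metric.mem_nhds_iff.mp hu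
  have ha := Metric.mem_ball_self (x := a) hε
  have hderiv : derivWithin g (Metric.ball a ε) a = g' :=
    hg'.hasDerivWithinAt.derivWithin (Metric.isOpen_ball.uniqueDiffWithinAt ha)
  have htaylor := taylor_isLittleO (n := 2) (convex_ball a ε) ha (hgu.mono hεu)
  rw [Metric.isOpen_ball.nhdsWithin_eq ha] at htaylor
  have hquad : (fun x => ((2 : ℝ)⁻¹ * (x - a) ^ 2) •
      iteratedDerivWithin 2 g (Metric.ball a ε) a) =O[𝓝 a] fun x => (x - a) ^ 2 := by
    simpa using ((isBigO_refl (fun x : ℝ => (x - a) ^ 2) (𝓝 a)).const_mul_left (2 : ℝ)⁻¹).smul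
      (isBigO_const_const (iteratedDerivWithin 2 g (Metric.ball a ε) a) (one_ne_zero' ℝ) (𝓝 a))
  refine (htaylor.isBigO.add hquad).congr_left fun x => ?_
  simp only [taylorWithinEval_succ, taylor_within_zero_eval]
  norm_num [hderiv]
  abel

section Resolvent

variable {n : Type*} [Fintype n] [DecidableEq n]

/-- The resolvent `(1 - h c A)⁻¹` applied to a smooth curve is smooth at `h = 0`. -/
theorem Matrix.contDiffAt_inv_one_sub_smul_mulVec (A : Matrix n n ℝ) (c : ℝ) {u : ℝ → n → ℝ}
    {m : WithTop ℕ∞} (hu : ContDiffAt ℝ m u 0) :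
    ContDiffAt ℝ m (fun h : ℝ => (1 - (h * c) • A)⁻¹ *ᵥ u h) 0 := by
  have hinv : ContDiffAt ℝ m (fun h : ℝ => (1 - (h * c) • A)⁻¹) 0 := by
    simp only [nonsing_inv_eq_ringInverse]
    refine ContDiffAt.comp (g := Ring.inverse) (f := fun h : ℝ => 1 - (h * c) • A) 0 ?_
      (by fun_prop)
    simpa using contDiffAt_ringInverse ℝ (1 : (Matrix n n ℝ)ˣ)
  exact (mulVecBilin (m := n) (n := n) ℝ ℝ).toContinuousBilinearMap.isBoundedBilinearMap.contDiff
    |>.contDiffAt.comp (0 : ℝ) (hinv.prodMk hu)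

/-- The derivative at `h = 0` of the resolvent `(1 - h c A)⁻¹` applied to a curve. -/
theorem Matrix.hasDerivAt_inv_one_sub_smul_mulVec (A : Matrix n n ℝ) (c : ℝ) {u : ℝ → n → ℝ}
    {u' : n → ℝ} (hu : HasDerivAt u u' 0) :
    HasDerivAt (fun h : ℝ => (1 - (h * c) • A)⁻¹ *ᵥ u h) (u' + c • A *ᵥ u 0) 0 := by
  have hlin : HasDerivAt (fun h : ℝ => 1 - (h * c) • A) (-(c • A)) 0 := by
    have h := (((hasDerivAt_id (0 : ℝ)).mul_const c).smul_const A).const_sub 1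
    simp only [id_eq, one_mul] at h
    exact h
  have hinv : HasDerivAt (fun h : ℝ => (1 - (h * c) • A)⁻¹) (c • A) 0 := by
    simp only [nonsing_inv_eq_ringInverse]
    have h := hasFDerivAt_ringInverse (𝕜 := ℝ) (1 : (Matrix n n ℝ)ˣ)
    rw [show ((1 : (Matrix n n ℝ)ˣ) : Matrix n n ℝ) = 1 - ((0 : ℝ) * c) • A by simp] at h
    have h := h.comp_hasDerivAt (0 : ℝ) hlin
    simp [Function.comp_def] at h
    exact h
  have h := (mulVecBilin (m := n) (n := n) ℝ ℝ).toContinuousBilinearMap.hasDerivAt_of_bilinear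
    (fun _ => hinv) (fun _ => hu)
  simpa [LinearMap.toContinuousBilinearMap_apply, smul_mulVec] using h

end Resolvent

/-- Second-order Taylor expansion of the two-stage LIRK one-step map:
`φ_p^h(U) = U + h(AU + f(U)) + (h²/2)(A + Df(U))(AU + f(U)) + O(h³)` as
`h → 0⁺`. -/
theorem lirk_step_taylor_expansion
    (d : ℕ) (A : Matrix (Fin d) (Fin d) ℝ) (f : (Fin d → ℝ) → (Fin d → ℝ))
    (hf : ContDiff ℝ 2 f)
    (p₁ p₂ : ℝ) (hp₁ : 0 < p₁) (hp₂ : 0 < p₂)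
    (U : Fin d → ℝ)
    (k₁ k₂ φ : ℝ → (Fin d → ℝ))
    (hk₁ : ∀ h : ℝ, 0 ≤ h →
      k₁ h = ((1 : Matrix (Fin d) (Fin d) ℝ) - (h * p₂) • A)⁻¹.mulVec
        (A.mulVec U + f U))
    (hk₂ : ∀ h : ℝ, 0 ≤ h →
      k₂ h = ((1 : Matrix (Fin d) (Fin d) ℝ) - (h * p₂) • A)⁻¹.mulVec
        (A.mulVec (U + (2 * h * p₁ * (1 / 2 - p₂)) • k₁ h)
          + f (U + (h * p₁) • k₁ h)))
    (hφ : ∀ h : ℝ, 0 ≤ h →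
      φ h = U + h • ((1 - 1 / (2 * p₁)) • k₁ h + (1 / (2 * p₁)) • k₂ h)) :
    (fun h : ℝ =>
        φ h - (U + h • (A.mulVec U + f U)
          + (h ^ 2 / 2) • (A.mulVec (A.mulVec U + f U)
              + fderiv ℝ f U (A.mulVec U + f U))))
      =O[nhdsWithin 0 (Set.Ioi 0)] (fun h : ℝ => h ^ 3) := by
  set v := A *ᵥ U + f U
  let K₁ : ℝ → Fin d → ℝ := fun h => (1 - (h * p₂) • A)⁻¹ *ᵥ v
  let w : ℝ → Fin d → ℝ := fun h =>
    A *ᵥ (U + (2 * h * p₁ * (1 / 2 - p₂)) • K₁ h) + f (U + (h * p₁) • K₁ h)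
  let K₂ : ℝ → Fin d → ℝ := fun h => (1 - (h * p₂) • A)⁻¹ *ᵥ w h
  let g : ℝ → Fin d → ℝ := fun h => (1 - 1 / (2 * p₁)) • K₁ h + (1 / (2 * p₁)) • K₂ h
  have hK₁0 : K₁ 0 = v := by simp [K₁]
  have hw0 : w 0 = v := by simp [w, v]
  have hK₂0 : K₂ 0 = v := by simp [K₂, hw0]
  have hg0 : g 0 = v := by simp only [g, hK₁0, hK₂0]; module
  have hK₁ : ContDiffAt ℝ 2 K₁ 0 := A.contDiffAt_inv_one_sub_smul_mulVec p₂ contDiffAt_const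
  have hK₁' : HasDerivAt K₁ (p₂ • A *ᵥ v) 0 := by
    simpa using A.hasDerivAt_inv_one_sub_smul_mulVec p₂ (hasDerivAt_const (0 : ℝ) v)
  let L : (Fin d → ℝ) →L[ℝ] Fin d → ℝ := A.mulVecLin.toContinuousLinearMap
  have hw : ContDiffAt ℝ 2 w 0 := by
    refine (L.contDiff.contDiffAt.comp (0 : ℝ) ?_).add (hf.contDiffAt.comp (0 : ℝ) ?_)
    · fun_prop
    · fun_prop
  have hstage (a : ℝ) : HasDerivAt (fun h : ℝ => U + (h * a) • K₁ h) (a • v) 0 := by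
    simpa [hK₁0] using (((hasDerivAt_id (0 : ℝ)).mul_const a).smul hK₁').const_add U
  have hw' : HasDerivAt w
      ((2 * p₁ * (1 / 2 - p₂)) • A *ᵥ v + p₁ • fderiv ℝ f U v) 0 := by
    have hlin := L.hasFDerivAt.comp_hasDerivAt (0 : ℝ) (hstage (2 * p₁ * (1 / 2 - p₂)))
    have hfU : HasFDerivAt f (fderiv ℝ f U) (U + ((0 : ℝ) * p₁) • K₁ 0) := by
      simpa using (hf.differentiable (by norm_num) U).hasFDerivAt
    convert! hlin.add (hfU.comp_hasDerivAt (0 : ℝ) (hstage p₁)) using 1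
    · ext1 h
      simp only [w, L, Function.comp_apply, Pi.add_apply, LinearMap.coe_toContinuousLinearMap',
        mulVecLin_apply]
      congr 4
      ring
    · simp [L]
  have hK₂ : ContDiffAt ℝ 2 K₂ 0 := A.contDiffAt_inv_one_sub_smul_mulVec p₂ hw
  have hK₂' := A.hasDerivAt_inv_one_sub_smul_mulVec p₂ hw'
  rw [hw0] at hK₂'
  have hg : ContDiffAt ℝ 2 g 0 := (hK₁.const_smul _).add (hK₂.const_smul _)
  have hg' : HasDerivAt g ((1 / 2 : ℝ) • (A *ᵥ v + fderiv ℝ f U v)) 0 := by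
    convert! (hK₁'.const_smul (1 - 1 / (2 * p₁))).add (hK₂'.const_smul (1 / (2 * p₁))) using 1
    match_scalars
    · field_simp
      ring
    · field_simp
  have hbound := (isBigO_refl (fun h : ℝ => h) (𝓝[>] 0)).smul
    ((hg.isBigO_sub_sub_smul_deriv hg').mono (nhdsWithin_le_nhds (s := Set.Ioi 0)))
  refine hbound.congr' ?_ (.of_forall fun h => by simp only [smul_eq_mul]; ring)
  filter_upwards [self_mem_nhdsWithin] with h hh
  have hφg : φ h = U + h • g h := by
    have h0 : 0 ≤ h := hh.le
    rw [hφ h h0, hk₂ h h0, hk₁ h h0]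
  rw [hφg, hg0]
  module
end

section
/- Let d ∈ ℕ, let A ∈ ℝ^{d×d}, let f : ℝ^d → ℝ^d be twice continuously differentiable, let p = (p_1, p_2) ∈ (0,∞)², let U ∈ ℝ^d, let ε > 0, and let u : (−ε, ε) → ℝ^d be differentiable with u(0) = U and u'(t) = A u(t) + f(u(t)) for all t ∈ (−ε, ε). Then the local error of the two-stage LIRK scheme satisfies φ_p^h(U) − u(h) = O(h³) as h → 0⁺ (with h small enough so that I_d − h p_2 A is invertible); i.e., the scheme is consistent of order two. -/
open Matrix Filter Asymptotics

section LocalExpansions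

variable {F E : Type*} [NormedAddCommGroup F] [NormedSpace ℝ F]
  [NormedAddCommGroup E] [NormedSpace ℝ E]

/-- If the derivative of `e` vanishes to order `n` at `a`, then `e - e a` vanishes to order
`n + 1`. -/
theorem isBigO_sub_pow_succ_of_hasFDerivAt {e : F → E} {e' : F → F →L[ℝ] E} {a : F} {n : ℕ}
    (he : ∀ᶠ x in nhds a, HasFDerivAt e (e' x) x)
    (hO : e' =O[nhds a] fun x => ‖x - a‖ ^ n) :
    (fun x => e x - e a) =O[nhds a] fun x => ‖x - a‖ ^ (n + 1) := by
  obtain ⟨C, hC⟩ := hO.bound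
  obtain ⟨r, hr, hball⟩ := Metric.eventually_nhds_iff_ball.1 (he.and hC)
  refine IsBigO.of_bound (max C 0) ?_
  filter_upwards [Metric.ball_mem_nhds a hr] with x hx
  have hseg : ∀ y ∈ segment ℝ a x, ‖y - a‖ ≤ ‖x - a‖ := fun y hy =>
    norm_sub_le_of_mem_segment hy
  have hmem : ∀ y ∈ segment ℝ a x, y ∈ Metric.ball a r := fun y hy =>
    (convex_ball a r).segment_subset (Metric.mem_ball_self hr) hx hy
  have hC0 : ∀ y ∈ segment ℝ a x, ‖e' y‖ ≤ max C 0 * ‖x - a‖ ^ n := fun y hy => by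
    have h1 := (hball y (hmem y hy)).2
    rw [norm_pow, norm_norm] at h1
    calc ‖e' y‖ ≤ C * ‖y - a‖ ^ n := h1
      _ ≤ max C 0 * ‖y - a‖ ^ n := by gcongr; exact le_max_left _ _
      _ ≤ max C 0 * ‖x - a‖ ^ n := by gcongr; exact hseg y hy
  have key := (convex_segment a x).norm_image_sub_le_of_norm_hasFDerivWithin_le
    (fun y hy => (hball y (hmem y hy)).1.hasFDerivWithinAt) hC0
    (left_mem_segment ℝ a x) (right_mem_segment ℝ a x)
  rw [pow_succ, norm_mul, norm_pow, norm_norm, ← mul_assoc]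
  exact key

/-- One-dimensional version of `isBigO_sub_pow_succ_of_hasFDerivAt` at the origin. -/
theorem isBigO_sub_pow_succ_of_hasDerivAt {e e' : ℝ → E} {n : ℕ}
    (he : ∀ᶠ t in nhds (0 : ℝ), HasDerivAt e (e' t) t)
    (hO : e' =O[nhds 0] fun t : ℝ => t ^ n) :
    (fun t => e t - e 0) =O[nhds 0] fun t : ℝ => t ^ (n + 1) := by
  have h := isBigO_sub_pow_succ_of_hasFDerivAt (n := n)
    (he.mono fun t ht => ht.hasFDerivAt) (IsBigO.of_norm_left ?_)
  · refine h.trans (IsBigO.of_norm_right ?_)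
    simpa using isBigO_refl (fun t : ℝ => |t| ^ (n + 1)) (nhds 0)
  · refine IsBigO.of_norm_right ?_
    simpa using hO.norm_left.norm_right

/-- First-order Taylor expansion of a `C²` function with quadratic remainder. -/
theorem ContDiff.isBigO_sub_sub_fderiv {f : F → E} (hf : ContDiff ℝ 2 f) (a : F) :
    (fun x => f x - f a - fderiv ℝ f a (x - a)) =O[nhds a] fun x => ‖x - a‖ ^ 2 := by
  have hd : Differentiable ℝ f := hf.differentiable (by norm_num)
  have hd' : Differentiable ℝ (fderiv ℝ f) :=
    (hf.fderiv_right (m := 1) (by norm_num)).differentiable (by norm_num)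
  have h := isBigO_sub_pow_succ_of_hasFDerivAt (n := 1) (a := a)
    (e := fun x => f x - fderiv ℝ f a x) (e' := fun x => fderiv ℝ f x - fderiv ℝ f a)
    (Eventually.of_forall fun x => (hd x).hasFDerivAt.sub (fderiv ℝ f a).hasFDerivAt)
    (by simpa using (hd' a).isBigO_sub.norm_right)
  refine h.congr_left fun x => ?_
  rw [map_sub]
  abel

/-- The solution of an implicit equation `x = b + h L x` with small `h` has the size of `b`. -/
theorem isBigO_of_eventually_eq_add_smul {l : Filter ℝ} (hl : l ≤ nhds 0) (L : E →L[ℝ] E)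
    {x b : ℝ → E} {s : ℝ → ℝ} (hx : ∀ᶠ h in l, x h = b h + h • L (x h)) (hb : b =O[l] s) :
    x =O[l] s := by
  refine IsBigO.trans (IsBigO.of_bound 2 ?_) hb
  have hsmall : ∀ᶠ h : ℝ in l, |h| * ‖L‖ < 1 / 2 := by
    refine Eventually.filter_mono hl (Tendsto.eventually_lt_const (v := 0) (by norm_num) ?_)
    have : Continuous fun h : ℝ => |h| * ‖L‖ := by fun_prop
    simpa using this.tendsto 0
  filter_upwards [hx, hsmall] with h h1 h2
  have h3 : ‖h • L (x h)‖ ≤ |h| * ‖L‖ * ‖x h‖ := by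
    rw [norm_smul, Real.norm_eq_abs, mul_assoc]
    gcongr
    exact L.le_opNorm _
  have h4 : ‖x h‖ ≤ ‖b h‖ + ‖h • L (x h)‖ := by
    conv_lhs => rw [h1]
    exact norm_add_le _ _
  nlinarith [norm_nonneg (x h)]

/-- Second-order expansion at `0` of a solution of the autonomous equation `u' = G(u)`. -/
theorem isBigO_sub_taylor_two_of_ode {G : E → E} (hG : ContDiff ℝ 2 G) {u : ℝ → E}
    (hu : ∀ᶠ t in nhds (0 : ℝ), HasDerivAt u (G (u t)) t) :
    (fun h => u h - (u 0 + h • G (u 0) + (h ^ 2 / 2) • fderiv ℝ G (u 0) (G (u 0))))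
      =O[nhds 0] fun h : ℝ => h ^ 3 := by
  have hu0 : HasDerivAt u (G (u 0)) 0 := hu.self_of_nhds
  have hut : Tendsto u (nhds 0) (nhds (u 0)) := hu0.continuousAt
  have hu1 : (fun t => u t - u 0) =O[nhds 0] fun t : ℝ => t := by
    simpa using hu0.differentiableAt.isBigO_sub
  have hGu : (fun t => G (u t) - G (u 0)) =O[nhds 0] fun t : ℝ => t ^ 1 := by
    simpa [Function.comp_def] using ((hG.differentiable (by norm_num) (u 0)).isBigO_sub.comp_tendsto hut).trans hu1
  have hu2 : (fun t => u t - u 0 - t • G (u 0)) =O[nhds 0] fun t : ℝ => t ^ 2 := by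
    have h := isBigO_sub_pow_succ_of_hasDerivAt (n := 1) (e := fun t => u t - t • G (u 0))
      (hu.mono fun t ht => by simpa using ht.fun_sub ((hasDerivAt_id t).smul_const (G (u 0)))) hGu
    refine h.congr_left fun t => ?_
    simp only [zero_smul, sub_zero]
    abel
  have hG2 : (fun t => G (u t) - G (u 0) - t • fderiv ℝ G (u 0) (G (u 0)))
      =O[nhds 0] fun t : ℝ => t ^ 2 := by
    have h1 := ((hG.isBigO_sub_sub_fderiv (u 0)).comp_tendsto hut).trans (hu1.norm_left.pow 2)
    have h2 := ((fderiv ℝ G (u 0)).isBigO_comp _ (nhds 0)).trans hu2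
    refine (h1.add h2).congr_left fun t => ?_
    simp only [Function.comp_apply, map_sub, map_smul]
    abel
  have h := isBigO_sub_pow_succ_of_hasDerivAt (n := 2)
    (e := fun t => u t - t • G (u 0) - (t ^ 2 / 2) • fderiv ℝ G (u 0) (G (u 0)))
    (hu.mono fun t ht => by
      have hsq : HasDerivAt (fun t : ℝ => t ^ 2 / 2) t t := by
        simpa using (hasDerivAt_pow 2 t).div_const 2
      simpa using (ht.fun_sub ((hasDerivAt_id t).smul_const (G (u 0)))).fun_sub
        (hsq.smul_const (fderiv ℝ G (u 0) (G (u 0))))) hG2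
  refine h.congr_left fun t => ?_
  simp only [zero_smul, sub_zero, ne_eq, OfNat.ofNat_ne_zero, not_false_eq_true, zero_pow,
    zero_div]
  abel

/-- Second-order expansion of the two-stage LIRK increment, with the stages given implicitly. -/
theorem isBigO_lirk_sub_taylor_two (L : E →L[ℝ] E) {f : E → E} (hf : ContDiff ℝ 2 f)
    {p₁ p₂ : ℝ} (hp₁ : p₁ ≠ 0) (U : E) {l : Filter ℝ} (hl : l ≤ nhds 0) {k₁ k₂ : ℝ → E}
    (hk₁ : ∀ᶠ h in l, k₁ h = L U + f U + (h * p₂) • L (k₁ h))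
    (hk₂ : ∀ᶠ h in l, k₂ h = L (U + (2 * h * p₁ * (1 / 2 - p₂)) • k₁ h)
      + f (U + (h * p₁) • k₁ h) + (h * p₂) • L (k₂ h)) :
    (fun h => h • ((1 - 1 / (2 * p₁)) • k₁ h + (1 / (2 * p₁)) • k₂ h)
      - (h • (L U + f U) + (h ^ 2 / 2) • (L (L U + f U) + fderiv ℝ f U (L U + f U))))
      =O[l] fun h : ℝ => h ^ 3 := by
  set v := L U + f U with hv
  have hk₁O : k₁ =O[l] fun _ => (1 : ℝ) :=
    isBigO_of_eventually_eq_add_smul hl (p₂ • L) (b := fun _ => v)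
      (hk₁.mono fun h e => by simpa [smul_smul] using e) (isBigO_const_const _ one_ne_zero _)
  -- multiplication by `h` and application of a fixed operator raises the order by one
  have step : ∀ (M : E →L[ℝ] E) (c : ℝ) (n : ℕ) (x : ℝ → E), x =O[l] (fun h : ℝ => h ^ n) →
      (fun h => (h * c) • M (x h)) =O[l] fun h : ℝ => h ^ (n + 1) := fun M c n x hx => by
    have h1 : (fun h : ℝ => h * c) =O[l] fun h : ℝ => h := by
      simpa [mul_comm] using (isBigO_refl (fun h : ℝ => h) l).const_mul_left c
    refine (h1.smul ((M.isBigO_comp x l).trans hx)).congr_right fun h => ?_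
    rw [smul_eq_mul, pow_succ']
  have hk₁O' : k₁ =O[l] fun h : ℝ => h ^ 0 := by simpa using hk₁O
  have hk₁v : (fun h => k₁ h - v) =O[l] fun h : ℝ => h ^ 1 :=
    (step L p₂ 0 k₁ hk₁O').congr' (hk₁.mono fun h e => by
      simp only []
      rw [eq_sub_iff_add_eq', ← e]) EventuallyEq.rfl
  have hk₁2 : (fun h => k₁ h - v - (h * p₂) • L v) =O[l] fun h : ℝ => h ^ 2 :=
    (step L p₂ 1 _ hk₁v).congr' (hk₁.mono fun h e => by
      simp only [map_sub, smul_sub, sub_left_inj]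
      rw [eq_sub_iff_add_eq', ← e]) EventuallyEq.rfl
  have hy : (fun h => (h * p₁) • k₁ h) =O[l] fun h : ℝ => h ^ 1 :=
    step (ContinuousLinearMap.id ℝ E) p₁ 0 k₁ hk₁O'
  have hyt : Tendsto (fun h => U + (h * p₁) • k₁ h) l (nhds U) := by
    have h0 : Tendsto (fun h : ℝ => h ^ 1) l (nhds 0) := by
      simpa using show Tendsto (fun h : ℝ => h) l (nhds 0) from hl
    simpa using (hy.trans_tendsto h0).const_add U
  have hfy : (fun h => f (U + (h * p₁) • k₁ h) - f U - (h * p₁) • fderiv ℝ f U v)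
      =O[l] fun h : ℝ => h ^ 2 := by
    have h1 := (hf.isBigO_sub_sub_fderiv U).comp_tendsto hyt
    simp only [Function.comp_def, add_sub_cancel_left] at h1
    have h2 := h1.trans (hy.norm_left.pow 2)
    simp only [← pow_mul, one_mul] at h2
    refine (h2.add (step (fderiv ℝ f U) p₁ 1 _ hk₁v)).congr_left fun h => ?_
    simp only [map_sub, map_smul, smul_sub]
    abel
  -- the difference of the stages solves an implicit equation with right-hand side `r`
  set c := p₁ * (1 - 2 * p₂) with hc
  set r : ℝ → E := fun h => (h * c) • L (k₁ h) + (f (U + (h * p₁) • k₁ h) - f U) with hr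
  have hr2 : (fun h => r h - h • (c • L v + p₁ • fderiv ℝ f U v)) =O[l] fun h : ℝ => h ^ 2 := by
    refine ((step L c 1 _ hk₁v).add hfy).congr_left fun h => ?_
    simp only [hr, map_sub, smul_sub, smul_add, smul_smul]
    abel
  have hr1 : r =O[l] fun h : ℝ => h ^ 1 := by
    have h1 : (fun h : ℝ => h • (c • L v + p₁ • fderiv ℝ f U v)) =O[l] fun h : ℝ => h ^ 1 := by
      simpa using step (ContinuousLinearMap.id ℝ E) 1 0
        (fun _ => c • L v + p₁ • fderiv ℝ f U v)
        (by simpa using isBigO_const_const _ (one_ne_zero (α := ℝ)) l)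
    have h2 : (fun h : ℝ => h ^ 2) =O[l] fun h : ℝ => h ^ 1 :=
      ((isLittleO_pow_pow one_lt_two).isBigO).mono hl
    simpa using (hr2.trans h2).add h1
  have hδ : ∀ᶠ h in l, k₂ h - k₁ h = r h + (h * p₂) • L (k₂ h - k₁ h) := by
    filter_upwards [hk₁, hk₂] with h e₁ e₂
    simp only [map_add, map_smul] at e₂
    simp only [hr, hc, map_sub]
    linear_combination (norm := module) e₂ - e₁ - hv
  have hδ1 : (fun h => k₂ h - k₁ h) =O[l] fun h : ℝ => h ^ 1 :=
    isBigO_of_eventually_eq_add_smul hl (p₂ • L)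
      (hδ.mono fun h e => by simpa [smul_smul] using e) hr1
  have hδ2 : (fun h => k₂ h - k₁ h - h • (c • L v + p₁ • fderiv ℝ f U v))
      =O[l] fun h : ℝ => h ^ 2 := by
    refine (hr2.add (step L p₂ 1 _ hδ1)).congr' (hδ.mono fun h e => ?_) EventuallyEq.rfl
    simp only []
    nth_rewrite 2 [e]
    abel
  refine (step (ContinuousLinearMap.id ℝ E) 1 2 _
    (hk₁2.add (hδ2.const_smul_left (1 / (2 * p₁))))).congr_left fun h => ?_
  simp only [ContinuousLinearMap.id_apply, hc, Pi.smul_apply]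
  match_scalars <;> field_simp <;> ring

end LocalExpansions

/-- For small `h`, the matrix `1 - h c A` is invertible. -/
theorem Matrix.eventually_isUnit_det_one_sub_smul {d : ℕ} (A : Matrix (Fin d) (Fin d) ℝ)
    (c : ℝ) :
    ∀ᶠ h : ℝ in nhds 0, IsUnit ((1 : Matrix (Fin d) (Fin d) ℝ) - (h * c) • A).det := by
  have hcont : Continuous fun h : ℝ =>
      ((1 : Matrix (Fin d) (Fin d) ℝ) - (h * c) • A).det := by fun_prop
  have h := hcont.continuousAt.eventually_ne (x := 0) (y := 0) (by simp)
  exact h.mono fun _ hh => hh.isUnit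

/-- Implicit form of a linearly implicit stage. -/
theorem Matrix.eq_add_smul_mulVec_of_eq_inv_mulVec {d : ℕ} {A : Matrix (Fin d) (Fin d) ℝ}
    {c : ℝ} (hA : IsUnit ((1 : Matrix (Fin d) (Fin d) ℝ) - c • A).det) {k b : Fin d → ℝ}
    (hk : k = ((1 : Matrix (Fin d) (Fin d) ℝ) - c • A)⁻¹.mulVec b) :
    k = b + c • A.mulVec k := by
  have h : ((1 : Matrix (Fin d) (Fin d) ℝ) - c • A).mulVec k = b := by
    rw [hk, mulVec_mulVec, mul_nonsing_inv _ hA, one_mulVec]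
  rw [sub_mulVec, one_mulVec, smul_mulVec] at h
  rw [← h, sub_add_cancel]

/-- Local error of the two-stage LIRK scheme for the semilinear ODE
`u' = Au + f(u)`, `u(0) = U`: `φ_p^h(U) − u(h) = O(h³)` as `h → 0⁺`, i.e. the
scheme is consistent of order two. -/
theorem lirk_scheme_local_error_order_two
    (d : ℕ) (A : Matrix (Fin d) (Fin d) ℝ) (f : (Fin d → ℝ) → (Fin d → ℝ))
    (hf : ContDiff ℝ 2 f)
    (p₁ p₂ : ℝ) (hp₁ : 0 < p₁) (hp₂ : 0 < p₂)
    (U : Fin d → ℝ) (ε : ℝ) (hε : 0 < ε)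
    (u : ℝ → (Fin d → ℝ))
    (hu0 : u 0 = U)
    (hu' : ∀ t ∈ Set.Ioo (-ε) ε, HasDerivAt u (A.mulVec (u t) + f (u t)) t)
    (k₁ k₂ φ : ℝ → (Fin d → ℝ))
    (hk₁ : ∀ h : ℝ, 0 ≤ h →
      k₁ h = ((1 : Matrix (Fin d) (Fin d) ℝ) - (h * p₂) • A)⁻¹.mulVec
        (A.mulVec U + f U))
    (hk₂ : ∀ h : ℝ, 0 ≤ h →
      k₂ h = ((1 : Matrix (Fin d) (Fin d) ℝ) - (h * p₂) • A)⁻¹.mulVec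
        (A.mulVec (U + (2 * h * p₁ * (1 / 2 - p₂)) • k₁ h)
          + f (U + (h * p₁) • k₁ h)))
    (hφ : ∀ h : ℝ, 0 ≤ h →
      φ h = U + h • ((1 - 1 / (2 * p₁)) • k₁ h + (1 / (2 * p₁)) • k₂ h)) :
    (fun h : ℝ => φ h - u h) =O[nhdsWithin 0 (Set.Ioi 0)] (fun h : ℝ => h ^ 3) := by
  set L : (Fin d → ℝ) →L[ℝ] (Fin d → ℝ) := A.mulVecLin.toContinuousLinearMap
  have hl : nhdsWithin (0 : ℝ) (Set.Ioi 0) ≤ nhds 0 := nhdsWithin_le_nhds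
  have hpos : ∀ᶠ h : ℝ in nhdsWithin 0 (Set.Ioi 0), 0 ≤ h :=
    eventually_mem_nhdsWithin.mono fun h hh => le_of_lt hh
  have hdet := (A.eventually_isUnit_det_one_sub_smul p₂).filter_mono hl
  have hscheme := isBigO_lirk_sub_taylor_two L hf (p₂ := p₂) hp₁.ne' U hl (k₁ := k₁) (k₂ := k₂)
    (by filter_upwards [hpos, hdet] with h h0 hA using
      eq_add_smul_mulVec_of_eq_inv_mulVec hA (hk₁ h h0))
    (by filter_upwards [hpos, hdet] with h h0 hA using
      eq_add_smul_mulVec_of_eq_inv_mulVec hA (hk₂ h h0))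
  have hexact := (isBigO_sub_taylor_two_of_ode (G := fun x => L x + f x) (L.contDiff.add hf)
    (u := u) (by filter_upwards [Ioo_mem_nhds (neg_lt_zero.2 hε) hε] with t ht using hu' t ht)
    ).mono hl
  have hG : fderiv ℝ (fun x => L x + f x) U = L + fderiv ℝ f U :=
    (L.hasFDerivAt.add (hf.differentiable (by norm_num) U).hasFDerivAt).fderiv
  rw [hu0, hG] at hexact
  refine (hscheme.sub hexact).congr' (hpos.mono fun h h0 => ?_) EventuallyEq.rfl
  simp only [hφ h h0, _root_.add_apply]
  abel
end
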